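/- arXiv:1205.4259 — 4 statements merged into one kernel-verified Lean document; each statement's English description precedes it below -/
import Mathlib

section
/- Let k ≥ 2, let θ ∈ S^{k-1}, and let w : [−1, 1] → ℝ be a measurable function such that x ↦ w(⟨x, θ⟩) is integrable with respect to the surface measure σ_{k-1} on S^{k-1}. Then the k×k matrix-valued integral satisfies ∫_{S^{k-1}} w(⟨x, θ⟩) S_θ(x) S_θ(x)ᵀ dσ_{k-1}(x) = (1/(k−1)) (∫_{S^{k-1}} w(⟨x, θ⟩) dσ_{k-1}(x)) (I_k − θθᵀ). -/
open MeasureTheory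
open scoped RealInnerProductSpace Classical

/-- Spherical sign of `x` relative to `θ`, set to `0` at `x = ±θ`. -/
noncomputable def sSign {k : ℕ} (θ x : EuclideanSpace ℝ (Fin k)) :
    EuclideanSpace ℝ (Fin k) :=
  if x = θ ∨ x = -θ then 0 else ‖x - ⟪x, θ⟫ • θ‖⁻¹ • (x - ⟪x, θ⟫ • θ)

/-- The surface area measure on the unit sphere `S^{k-1} ⊆ ℝ^k`: the
`(k−1)`-dimensional Hausdorff measure restricted to the sphere. -/
noncomputable def sphereMeasure (k : ℕ) : Measure (EuclideanSpace ℝ (Fin k)) :=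
  (Measure.hausdorffMeasure ((k : ℝ) - 1)).restrict
    (Metric.sphere (0 : EuclideanSpace ℝ (Fin k)) 1)

lemma sSign_eq_normalize {k : ℕ} {θ : EuclideanSpace ℝ (Fin k)} (hθ : ‖θ‖ = 1)
    (x : EuclideanSpace ℝ (Fin k)) :
    sSign θ x = ‖x - ⟪x, θ⟫ • θ‖⁻¹ • (x - ⟪x, θ⟫ • θ) := by
  unfold sSign
  split_ifs with h
  · rcases h with rfl | rfl <;> simp [hθ]
  · rfl

lemma measurable_sSign {k : ℕ} {θ : EuclideanSpace ℝ (Fin k)} (hθ : ‖θ‖ = 1) :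
    Measurable (sSign θ) := by
  rw [funext (sSign_eq_normalize hθ)]
  fun_prop

lemma norm_sSign_le_one {k : ℕ} {θ : EuclideanSpace ℝ (Fin k)} (hθ : ‖θ‖ = 1)
    (x : EuclideanSpace ℝ (Fin k)) : ‖sSign θ x‖ ≤ 1 := by
  rw [sSign_eq_normalize hθ, norm_smul, norm_inv, norm_norm]
  exact inv_mul_le_one

lemma inner_sSign_self {k : ℕ} {θ : EuclideanSpace ℝ (Fin k)} (hθ : ‖θ‖ = 1)
    (x : EuclideanSpace ℝ (Fin k)) : ⟪sSign θ x, θ⟫ = 0 := by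
  simp [sSign_eq_normalize hθ, inner_smul_left, inner_sub_left, hθ]

lemma norm_sSign_eq_one {k : ℕ} {θ x : EuclideanSpace ℝ (Fin k)} (hθ : ‖θ‖ = 1)
    (hx : ‖x‖ = 1) (h₁ : x ≠ θ) (h₂ : x ≠ -θ) : ‖sSign θ x‖ = 1 := by
  have hne : x - ⟪x, θ⟫ • θ ≠ 0 := by
    intro h
    have hx' : x = ⟪x, θ⟫ • θ := sub_eq_zero.mp h
    have habs : |⟪x, θ⟫| = 1 := by
      have := congrArg norm hx'
      rw [norm_smul, hθ, hx, mul_one, Real.norm_eq_abs] at this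
      exact this.symm
    rcases eq_or_eq_neg_of_abs_eq habs with h | h
    · exact h₁ (by rw [hx', h, one_smul])
    · exact h₂ (by rw [hx', h, neg_one_smul])
  rw [sSign_eq_normalize hθ, norm_smul, norm_inv, norm_norm,
    inv_mul_cancel₀ (norm_ne_zero_iff.mpr hne)]

lemma sSign_map {k : ℕ} {θ : EuclideanSpace ℝ (Fin k)} (hθ : ‖θ‖ = 1)
    (L : EuclideanSpace ℝ (Fin k) ≃ₗᵢ[ℝ] EuclideanSpace ℝ (Fin k)) (hL : L θ = θ)
    (x : EuclideanSpace ℝ (Fin k)) : sSign θ (L x) = L (sSign θ x) := by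
  have hin : ⟪L x, θ⟫ = ⟪x, θ⟫ := by
    conv_lhs => rw [← hL]
    exact L.inner_map_map x θ
  have hsub : L x - ⟪x, θ⟫ • θ = L (x - ⟪x, θ⟫ • θ) := by
    rw [map_sub, map_smul, hL]
  rw [sSign_eq_normalize hθ, sSign_eq_normalize hθ, hin, hsub, L.norm_map, map_smul]

lemma measurePreserving_sphereMeasure {k : ℕ}
    (L : EuclideanSpace ℝ (Fin k) ≃ₗᵢ[ℝ] EuclideanSpace ℝ (Fin k)) :
    MeasurePreserving L (sphereMeasure k) (sphereMeasure k) := by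
  have h := (L.toIsometryEquiv.measurePreserving_hausdorffMeasure ((k : ℝ) - 1)).restrict_preimage
    (s := Metric.sphere (0 : EuclideanSpace ℝ (Fin k)) 1) Metric.isClosed_sphere.measurableSet
  have hpre : L.toIsometryEquiv ⁻¹' Metric.sphere (0 : EuclideanSpace ℝ (Fin k)) 1
      = Metric.sphere 0 1 := by
    ext x
    simp
  rw [hpre] at h
  exact h

lemma ae_norm_sSign_eq_one {k : ℕ} (hk : 2 ≤ k) {θ : EuclideanSpace ℝ (Fin k)} (hθ : ‖θ‖ = 1) :
    ∀ᵐ x ∂(sphereMeasure k), ‖sSign θ x‖ = 1 := by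
  have hpos : 0 < (k : ℝ) - 1 := by
    have : (2 : ℝ) ≤ k := by exact_mod_cast hk
    linarith
  have := Measure.nullSingletonClass_hausdorff (EuclideanSpace ℝ (Fin k)) hpos
  unfold sphereMeasure
  filter_upwards [ae_restrict_mem Metric.isClosed_sphere.measurableSet,
    ae_restrict_of_ae (Measure.ae_ne _ θ), ae_restrict_of_ae (Measure.ae_ne _ (-θ))]
    with x hx h₁ h₂
  exact norm_sSign_eq_one hθ (by simpa using hx) h₁ h₂

/-- The bilinear form of weighted second moments of the spherical sign. -/
noncomputable def signMoment {k : ℕ} (θ : EuclideanSpace ℝ (Fin k)) (w : ℝ → ℝ)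
    (u v : EuclideanSpace ℝ (Fin k)) : ℝ :=
  ∫ x, w ⟪x, θ⟫ * (⟪sSign θ x, u⟫ * ⟪sSign θ x, v⟫) ∂(sphereMeasure k)

section SignMoment

variable {k : ℕ} {θ : EuclideanSpace ℝ (Fin k)} {w : ℝ → ℝ}

lemma integrable_signMoment (hθ : ‖θ‖ = 1)
    (hint : Integrable (fun x => w ⟪x, θ⟫) (sphereMeasure k))
    (u v : EuclideanSpace ℝ (Fin k)) :
    Integrable (fun x => w ⟪x, θ⟫ * (⟪sSign θ x, u⟫ * ⟪sSign θ x, v⟫)) (sphereMeasure k) := by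
  have hS := measurable_sSign hθ
  have hb (x u : EuclideanSpace ℝ (Fin k)) : ‖⟪sSign θ x, u⟫‖ ≤ ‖u‖ :=
    (norm_inner_le_norm _ _).trans
      (mul_le_of_le_one_left (norm_nonneg u) (norm_sSign_le_one hθ x))
  refine hint.mul_bdd (c := ‖u‖ * ‖v‖) (by fun_prop) (ae_of_all _ fun x => ?_)
  rw [norm_mul]
  exact mul_le_mul (hb x u) (hb x v) (norm_nonneg _) (norm_nonneg _)

lemma signMoment_map (hθ : ‖θ‖ = 1)
    (L : EuclideanSpace ℝ (Fin k) ≃ₗᵢ[ℝ] EuclideanSpace ℝ (Fin k)) (hL : L θ = θ)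
    (u v : EuclideanSpace ℝ (Fin k)) :
    signMoment θ w (L u) (L v) = signMoment θ w u v := by
  unfold signMoment
  rw [← (measurePreserving_sphereMeasure L).integral_comp
    L.toHomeomorph.measurableEmbedding]
  refine integral_congr_ae (ae_of_all _ fun x => ?_)
  have hin : ⟪L x, θ⟫ = ⟪x, θ⟫ := by
    conv_lhs => rw [← hL]
    exact L.inner_map_map x θ
  simp only [sSign_map hθ L hL, L.inner_map_map, hin]

lemma signMoment_smul (c : ℝ) (u : EuclideanSpace ℝ (Fin k)) :
    signMoment θ w (c • u) (c • u) = c ^ 2 * signMoment θ w u u := by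
  unfold signMoment
  rw [← integral_const_mul]
  refine integral_congr_ae (ae_of_all _ fun x => ?_)
  simp only [inner_smul_right]
  ring

lemma signMoment_sub_smul (hθ : ‖θ‖ = 1) (c : ℝ) (u : EuclideanSpace ℝ (Fin k)) :
    signMoment θ w (u - c • θ) (u - c • θ) = signMoment θ w u u := by
  simp only [signMoment, inner_sub_right, inner_smul_right, inner_sSign_self hθ, mul_zero,
    sub_zero]

lemma signMoment_polarization (hθ : ‖θ‖ = 1)
    (hint : Integrable (fun x => w ⟪x, θ⟫) (sphereMeasure k))
    (u v : EuclideanSpace ℝ (Fin k)) :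
    4 * signMoment θ w u v =
      signMoment θ w (u + v) (u + v) - signMoment θ w (u - v) (u - v) := by
  unfold signMoment
  rw [← integral_sub (integrable_signMoment hθ hint _ _) (integrable_signMoment hθ hint _ _),
    ← integral_const_mul]
  refine integral_congr_ae (ae_of_all _ fun x => ?_)
  simp only [inner_add_right, inner_sub_right]
  ring

/-- A reflection fixing `θ` exchanges vectors of equal norm orthogonal to `θ`. -/
lemma signMoment_eq_of_norm_eq (hθ : ‖θ‖ = 1) {u v : EuclideanSpace ℝ (Fin k)}
    (hu : ⟪u, θ⟫ = 0) (hv : ⟪v, θ⟫ = 0) (h : ‖u‖ = ‖v‖) :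
    signMoment θ w u u = signMoment θ w v v := by
  have hL : (ℝ ∙ (u - v))ᗮ.reflection θ = θ := by
    apply Submodule.reflection_mem_subspace_eq_self
    rw [Submodule.mem_orthogonal_singleton_iff_inner_right, inner_sub_left, hu, hv, sub_zero]
  have := signMoment_map (w := w) hθ (ℝ ∙ (u - v))ᗮ.reflection hL u u
  rwa [Submodule.reflection_sub h, eq_comm] at this

lemma exists_signMoment_self_eq (hk : 2 ≤ k) (hθ : ‖θ‖ = 1) (w : ℝ → ℝ) :
    ∃ c : ℝ, ∀ u, signMoment θ w u u = c * (‖u‖ ^ 2 - ⟪u, θ⟫ ^ 2) := by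
  obtain ⟨z, hz, hz0⟩ : ∃ z ∈ (ℝ ∙ θ)ᗮ, z ≠ 0 := by
    apply Submodule.exists_mem_ne_zero_of_ne_bot
    rw [Ne, Submodule.orthogonal_eq_bot_iff]
    intro htop
    have h := finrank_span_singleton (K := ℝ) (v := θ) (norm_ne_zero_iff.mp (by simp [hθ]))
    rw [htop, finrank_top, finrank_euclideanSpace_fin] at h
    omega
  rw [Submodule.mem_orthogonal_singleton_iff_inner_left] at hz
  have hzn : ‖z‖ ≠ 0 := norm_ne_zero_iff.mpr hz0
  refine ⟨(‖z‖ ^ 2)⁻¹ * signMoment θ w z z, fun u => ?_⟩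
  set y := u - ⟪u, θ⟫ • θ with hy
  have hyθ : ⟪y, θ⟫ = 0 := by simp [hy, inner_sub_left, inner_smul_left, hθ]
  have hynorm : ‖y‖ ^ 2 = ‖u‖ ^ 2 - ⟪u, θ⟫ ^ 2 := by
    rw [hy, norm_sub_sq_real, inner_smul_right, norm_smul, hθ, Real.norm_eq_abs, mul_one, sq_abs]
    ring
  rw [← signMoment_sub_smul hθ ⟪u, θ⟫ u, ← hy, ← hynorm,
    signMoment_eq_of_norm_eq (v := (‖y‖ / ‖z‖) • z) hθ hyθ
      (by rw [inner_smul_left, hz, mul_zero])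
      (by rw [norm_smul, norm_div, norm_norm, norm_norm, div_mul_cancel₀ _ hzn]),
    signMoment_smul]
  field_simp

lemma sum_signMoment_single (hk : 2 ≤ k) (hθ : ‖θ‖ = 1)
    (hint : Integrable (fun x => w ⟪x, θ⟫) (sphereMeasure k)) :
    ∑ i, signMoment θ w (EuclideanSpace.single i 1) (EuclideanSpace.single i 1) =
      ∫ x, w ⟪x, θ⟫ ∂(sphereMeasure k) := by
  unfold signMoment
  rw [← integral_finsetSum _ fun i _ => integrable_signMoment hθ hint _ _]
  refine integral_congr_ae ?_
  filter_upwards [ae_norm_sSign_eq_one hk hθ] with x hx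
  have hsum : ∑ i, sSign θ x i * sSign θ x i = 1 := by
    have := EuclideanSpace.real_norm_sq_eq (sSign θ x)
    rw [hx] at this
    simpa [sq] using this.symm
  simp [← Finset.mul_sum, EuclideanSpace.inner_single_right, hsum]

end SignMoment

/-- for any integrable weight `w(⟨x,θ⟩)`, the matrix-valued integral of
`w(⟨x,θ⟩) S_θ(x) S_θ(x)ᵀ` over the sphere equals
`(1/(k−1)) (∫ w(⟨x,θ⟩) dσ) (I_k − θθᵀ)` (stated entrywise). -/
theorem stmt6 {k : ℕ} (hk : 2 ≤ k) (θ : EuclideanSpace ℝ (Fin k)) (hθ : ‖θ‖ = 1)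
    (w : ℝ → ℝ) (hw : Measurable w)
    (hint : Integrable (fun x => w ⟪x, θ⟫) (sphereMeasure k)) :
    ∀ a b : Fin k,
      ∫ x, w ⟪x, θ⟫ * (sSign θ x a * sSign θ x b) ∂(sphereMeasure k) =
        (1 / ((k : ℝ) - 1)) * (∫ x, w ⟪x, θ⟫ ∂(sphereMeasure k)) *
          ((if a = b then 1 else 0) - θ a * θ b) := by
  intro a b
  obtain ⟨c, hc⟩ := exists_signMoment_self_eq hk hθ w
  have hB (u v : EuclideanSpace ℝ (Fin k)) :
      signMoment θ w u v = c * (⟪u, v⟫ - ⟪u, θ⟫ * ⟪v, θ⟫) := by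
    have h := signMoment_polarization hθ hint u v
    rw [hc, hc, norm_add_sq_real, norm_sub_sq_real, inner_add_left, inner_sub_left] at h
    linarith
  have hk1 : (k : ℝ) - 1 ≠ 0 := by
    have : (2 : ℝ) ≤ k := by exact_mod_cast hk
    linarith
  have htrace : ∫ x, w ⟪x, θ⟫ ∂(sphereMeasure k) = c * ((k : ℝ) - 1) := by
    have hsum : ∑ i, θ i ^ 2 = 1 := by
      rw [← EuclideanSpace.real_norm_sq_eq, hθ, one_pow]
    rw [← sum_signMoment_single hk hθ hint]
    simp [hc, EuclideanSpace.inner_single_left, ← Finset.mul_sum, Finset.sum_sub_distrib, hsum]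
  have hab := hB (EuclideanSpace.single a 1) (EuclideanSpace.single b 1)
  simp only [signMoment, EuclideanSpace.inner_single_left, EuclideanSpace.inner_single_right,
    map_one, one_mul, conj_trivial] at hab
  rw [hab, htrace, PiLp.single_apply]
  simp only [eq_comm (a := b)]
  field_simp
end

section
/- Let k ≥ 2 and m ≥ 1, let θ ∈ ℝ^k be a unit vector and set P := I_k − θθᵀ. Let a_1, …, a_m, b_1, …, b_m, r_1, …, r_m be positive reals and H := Σ_{l=1}^{m} r_l b_l²/a_l. Define the (mk)×(mk) matrix Γ⊥ whose (i,j) k×k block is δ_{ij} a_i^{-1} P − H^{-1} (b_i b_j √(r_i r_j)/(a_i a_j)) P, the (mk)×(mk) block-diagonal matrix Γ^φ with i-th diagonal block b_i P, and the (mk)×k matrix Υ whose i-th k×k block is √(r_i) P. Then Γ⊥ Γ^φ Υ = 0. -/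
open scoped RealInnerProductSpace Classical

/-- The projection matrix `P = I_k − θθᵀ`. -/
noncomputable def Pmat {k : ℕ} (θ : EuclideanSpace ℝ (Fin k)) :
    Matrix (Fin k) (Fin k) ℝ :=
  Matrix.of fun a b => (if a = b then 1 else 0) - θ a * θ b

/-- The `(mk)×(mk)` matrix `Γ⊥` with `(i,j)` block
`δ_{ij} a_i⁻¹ P − H⁻¹ (b_i b_j √(r_i r_j)/(a_i a_j)) P`, where `H = Σ_l r_l b_l²/a_l`. -/
noncomputable def GammaPerp {k m : ℕ} (θ : EuclideanSpace ℝ (Fin k))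
    (A B R : Fin m → ℝ) : Matrix (Fin m × Fin k) (Fin m × Fin k) ℝ :=
  Matrix.of fun p q =>
    (if p.1 = q.1 then (A p.1)⁻¹ * Pmat θ p.2 q.2 else 0)
      - (∑ l, R l * B l ^ 2 / A l)⁻¹
          * (B p.1 * B q.1 * Real.sqrt (R p.1 * R q.1) / (A p.1 * A q.1))
          * Pmat θ p.2 q.2

/-- The scalar coefficients `δ_{ij} a_i⁻¹ − H⁻¹ b_i b_j √(r_i r_j)/(a_i a_j)` annihilate the
vector with entries `b_j √r_j`. -/
theorem sum_coeff_mul_eq_zero {m : ℕ} (A B R : Fin m → ℝ) (hA : ∀ i, 0 < A i)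
    (hB : ∀ i, 0 < B i) (hR : ∀ i, 0 < R i) (i : Fin m) :
    ∑ j, ((if i = j then (A i)⁻¹ else 0)
        - (∑ l, R l * B l ^ 2 / A l)⁻¹ * (B i * B j * √(R i * R j) / (A i * A j)))
          * (B j * √(R j)) = 0 := by
  have hpos : 0 < ∑ l, R l * B l ^ 2 / A l :=
    Finset.sum_pos (fun l _ => div_pos (mul_pos (hR l) (pow_pos (hB l) 2)) (hA l))
      ⟨i, Finset.mem_univ i⟩
  have hterm (j : Fin m) : B i * B j * √(R i * R j) / (A i * A j) * (B j * √(R j))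
      = (A i)⁻¹ * (B i * √(R i)) * (R j * B j ^ 2 / A j) := by
    have hi := (hA i).ne'
    have hj := (hA j).ne'
    rw [Real.sqrt_mul (hR i).le]
    nth_rewrite 3 [← Real.mul_self_sqrt (hR j).le]
    field_simp
  simp only [sub_mul, ite_mul, zero_mul, Finset.sum_sub_distrib, Finset.sum_ite_eq,
    Finset.mem_univ, if_true, mul_assoc (∑ l, R l * B l ^ 2 / A l)⁻¹, hterm, ← Finset.mul_sum]
  field_simp
  ring

theorem blockDiag_mul_blockColumn {k m : ℕ} (P : Matrix (Fin k) (Fin k) ℝ) (B w : Fin m → ℝ) :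
    (Matrix.of fun p q : Fin m × Fin k => if p.1 = q.1 then B p.1 * P p.2 q.2 else 0)
        * (Matrix.of fun (p : Fin m × Fin k) (b : Fin k) => w p.1 * P p.2 b)
      = Matrix.of fun (p : Fin m × Fin k) (b : Fin k) => B p.1 * w p.1 * (P * P) p.2 b := by
  ext p b
  simp only [Matrix.mul_apply, Matrix.of_apply, Fintype.sum_prod_type, ite_mul, zero_mul]
  rw [Finset.sum_comm]
  simp only [Finset.sum_ite_eq, Finset.mem_univ, if_true, Finset.mul_sum]
  exact Finset.sum_congr rfl fun c _ => by ring

/-- with `Γ^φ` the block-diagonal matrix with blocks `b_i P` and `Υ`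
the `(mk)×k` matrix with blocks `√(r_i) P`, one has `Γ⊥ Γ^φ Υ = 0`. -/
theorem stmt13 {k m : ℕ} (hk : 2 ≤ k) (hm : 1 ≤ m)
    (θ : EuclideanSpace ℝ (Fin k)) (hθ : ‖θ‖ = 1)
    (A B R : Fin m → ℝ) (hA : ∀ i, 0 < A i) (hB : ∀ i, 0 < B i) (hR : ∀ i, 0 < R i) :
    GammaPerp θ A B R
        * (Matrix.of fun p q : Fin m × Fin k =>
            if p.1 = q.1 then B p.1 * Pmat θ p.2 q.2 else 0)
        * (Matrix.of fun (p : Fin m × Fin k) (b : Fin k) =>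
            Real.sqrt (R p.1) * Pmat θ p.2 b)
      = 0 := by
  rw [Matrix.mul_assoc, blockDiag_mul_blockColumn (Pmat θ) B fun i => √(R i)]
  ext ⟨i, a⟩ b
  have hsplit (j : Fin m) (c : Fin k) :
      GammaPerp θ A B R (i, a) (j, c) * (B j * √(R j) * (Pmat θ * Pmat θ) c b)
        = ((if i = j then (A i)⁻¹ else 0)
            - (∑ l, R l * B l ^ 2 / A l)⁻¹ * (B i * B j * √(R i * R j) / (A i * A j)))
              * (B j * √(R j)) * (Pmat θ a c * (Pmat θ * Pmat θ) c b) := by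
    simp only [GammaPerp, Matrix.of_apply]
    split_ifs <;> ring
  rw [Matrix.mul_apply, Fintype.sum_prod_type]
  simp only [Matrix.of_apply, hsplit, ← Finset.mul_sum, ← Finset.sum_mul,
    sum_coeff_mul_eq_zero A B R hA hB hR i, zero_mul, Matrix.zero_apply]
end

section
/- Let k ≥ 2 and m ≥ 1, let θ ∈ ℝ^k be a unit vector and set P := I_k − θθᵀ. Let a_1, …, a_m, b_1, …, b_m, r_1, …, r_m be positive reals and H := Σ_{l=1}^{m} r_l b_l²/a_l. Define the (mk)×(mk) matrix Γ⊥ whose (i,j) k×k block is δ_{ij} a_i^{-1} P − H^{-1} (b_i b_j √(r_i r_j)/(a_i a_j)) P, and the (mk)×(mk) block-diagonal matrix Γ* with i-th diagonal block a_i P. Then the matrix M := Γ* Γ⊥ is idempotent (M² = M) and has trace (m − 1)(k − 1). -/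
open scoped RealInnerProductSpace Classical

open Matrix in
/-- The rank-one perturbation `1 - x yᵀ` with `y ⬝ x = 1` is idempotent. -/
theorem isIdempotentElem_one_sub_vecMulVec {n : Type*} [Fintype n] [DecidableEq n]
    {x y : n → ℝ} (h : y ⬝ᵥ x = 1) : IsIdempotentElem (1 - vecMulVec x y) := by
  apply IsIdempotentElem.one_sub
  rw [IsIdempotentElem, vecMulVec_mul_vecMulVec, h, one_smul]

open Matrix in
theorem trace_one_sub_vecMulVec {n : Type*} [Fintype n] [DecidableEq n]
    {x y : n → ℝ} (h : y ⬝ᵥ x = 1) :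
    (1 - vecMulVec x y).trace = (Fintype.card n : ℝ) - 1 := by
  rw [trace_sub, trace_one, trace_vecMulVec, dotProduct_comm, h]

open Matrix in
theorem Pmat_eq_one_sub_vecMulVec {k : ℕ} (θ : EuclideanSpace ℝ (Fin k)) :
    Pmat θ = 1 - vecMulVec θ θ := by
  ext a b
  simp [Pmat, vecMulVec_apply, one_apply]

open Matrix in
theorem dotProduct_self_eq_one_of_norm_eq_one {k : ℕ} {θ : EuclideanSpace ℝ (Fin k)}
    (hθ : ‖θ‖ = 1) : (θ : Fin k → ℝ) ⬝ᵥ θ = 1 := by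
  have h := EuclideanSpace.real_norm_sq_eq θ
  rw [hθ] at h
  simpa [dotProduct, sq] using h.symm

open Matrix Kronecker in
theorem blockDiagonal_Pmat_eq_kronecker {k m : ℕ} (θ : EuclideanSpace ℝ (Fin k))
    (A : Fin m → ℝ) :
    (Matrix.of fun p q : Fin m × Fin k =>
      if p.1 = q.1 then A p.1 * Pmat θ p.2 q.2 else 0) = diagonal A ⊗ₖ Pmat θ := by
  ext p q
  simp [kroneckerMap_apply, diagonal_apply]

open Matrix Kronecker in
theorem GammaPerp_eq_kronecker {k m : ℕ} (θ : EuclideanSpace ℝ (Fin k))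
    (A B R : Fin m → ℝ) (hR : ∀ i, 0 < R i) :
    GammaPerp θ A B R =
      (diagonal (fun i => (A i)⁻¹) - vecMulVec
        (fun i => (∑ l, R l * B l ^ 2 / A l)⁻¹ * (B i * √(R i) / A i))
        (fun i => B i * √(R i) / A i)) ⊗ₖ Pmat θ := by
  ext p q
  simp only [GammaPerp, of_apply, kroneckerMap_apply, Matrix.sub_apply, diagonal_apply,
    vecMulVec_apply, Real.sqrt_mul (hR p.1).le, sub_mul, ite_mul, zero_mul]
  ring

open Matrix Kronecker in
/-- with `Γ*` the block-diagonal matrix with blocks `a_i P`, the matrix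
`M = Γ* Γ⊥` is idempotent with trace `(m−1)(k−1)`. -/
theorem stmt14 {k m : ℕ} (hk : 2 ≤ k) (hm : 1 ≤ m)
    (θ : EuclideanSpace ℝ (Fin k)) (hθ : ‖θ‖ = 1)
    (A B R : Fin m → ℝ) (hA : ∀ i, 0 < A i) (hB : ∀ i, 0 < B i) (hR : ∀ i, 0 < R i)
    (M : Matrix (Fin m × Fin k) (Fin m × Fin k) ℝ)
    (hM : M = (Matrix.of fun p q : Fin m × Fin k =>
        if p.1 = q.1 then A p.1 * Pmat θ p.2 q.2 else 0) * GammaPerp θ A B R) :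
    M * M = M ∧ Matrix.trace M = ((m : ℝ) - 1) * ((k : ℝ) - 1) := by
  have hθθ := dotProduct_self_eq_one_of_norm_eq_one hθ
  have hP : IsIdempotentElem (Pmat θ) := by
    rw [Pmat_eq_one_sub_vecMulVec]
    exact isIdempotentElem_one_sub_vecMulVec hθθ
  have hPtr : (Pmat θ).trace = (k : ℝ) - 1 := by
    rw [Pmat_eq_one_sub_vecMulVec, trace_one_sub_vecMulVec hθθ, Fintype.card_fin]
  have : Nonempty (Fin m) := ⟨⟨0, hm⟩⟩
  have hH : 0 < ∑ l, R l * B l ^ 2 / A l :=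
    Finset.sum_pos (fun l _ => by have := hA l; have := hB l; have := hR l; positivity)
      Finset.univ_nonempty
  rw [blockDiagonal_Pmat_eq_kronecker, GammaPerp_eq_kronecker θ A B R hR,
    ← mul_kronecker_mul, hP.eq] at hM
  set H := ∑ l, R l * B l ^ 2 / A l with hHdef
  let x : Fin m → ℝ := fun i => H⁻¹ * (B i * √(R i))
  let y : Fin m → ℝ := fun i => B i * √(R i) / A i
  have hyx : y ⬝ᵥ x = 1 := by
    have h : ∀ i, y i * x i = H⁻¹ * (R i * B i ^ 2 / A i) := fun i => by
      simp only [x, y]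
      nth_rewrite 3 [← Real.mul_self_sqrt (hR i).le]
      ring
    rw [dotProduct, Finset.sum_congr rfl fun i _ => h i, ← Finset.mul_sum, ← hHdef,
      inv_mul_cancel₀ hH.ne']
  have hC : diagonal A * (diagonal (fun i => (A i)⁻¹) - vecMulVec
      (fun i => H⁻¹ * (B i * √(R i) / A i)) y) = 1 - vecMulVec x y := by
    ext i j
    have hAi := (hA i).ne'
    rw [diagonal_mul, Matrix.sub_apply, Matrix.sub_apply, diagonal_apply, one_apply, mul_sub, mul_ite,
      mul_zero, mul_inv_cancel₀ hAi, vecMulVec_apply, vecMulVec_apply]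
    simp only [x]
    field_simp
  rw [hC] at hM
  subst hM
  constructor
  · rw [← mul_kronecker_mul, hP.eq, (isIdempotentElem_one_sub_vecMulVec hyx).eq]
  · rw [trace_kronecker, hPtr, trace_one_sub_vecMulVec hyx, Fintype.card_fin]
end

section
/- Let k ≥ 2 and m ≥ 1, let θ ∈ ℝ^k be a unit vector and set P := I_k − θθᵀ. Let n_1, …, n_m > 0 with n := Σ_i n_i and r_i := n_i/n; let κ_1, …, κ_m > 0, B_1, …, B_m > 0 and E_1, …, E_m ≠ 0 be reals; set D_i := E_i/B_i, H := Σ_{i=1}^{m} r_i D_i² B_i, a_i := κ_i² B_i/(k−1) and b_i := κ_i E_i. Let v_1, …, v_m ∈ ℝ^k and let Δ ∈ ℝ^{mk} be the stacked vector with i-th block Δ_i := κ_i √(n_i) P v_i. Let Γ⊥ be the (mk)×(mk) matrix whose (i,j) k×k block is δ_{ij} a_i^{-1} P − H'^{-1} (b_i b_j √(r_i r_j)/(a_i a_j)) P with H' := Σ_l r_l b_l²/a_l. Then Δᵀ Γ⊥ Δ = (k−1) [ Σ_{i=1}^{m} n_i (D_i/E_i) v_iᵀ P v_i − Σ_{i,j=1}^{m}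 (n_i n_j/n)(D_i D_j/H) v_iᵀ P v_j ]. In particular the quadratic form does not depend on the constants κ_1, …, κ_m. -/
open scoped RealInnerProductSpace Classical Matrix

lemma Pmat_eq {k : ℕ} (θ : EuclideanSpace ℝ (Fin k)) :
    Pmat θ = 1 - Matrix.vecMulVec θ θ := by
  ext a b
  simp [Pmat, Matrix.one_apply, Matrix.vecMulVec_apply]

lemma Pmat_transpose {k : ℕ} (θ : EuclideanSpace ℝ (Fin k)) : (Pmat θ)ᵀ = Pmat θ := by
  simp [Pmat_eq, Matrix.transpose_vecMulVec]

lemma Pmat_mul_self {k : ℕ} (θ : EuclideanSpace ℝ (Fin k)) (hθ : ‖θ‖ = 1) :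
    Pmat θ * Pmat θ = Pmat θ := by
  have hdot : (θ : Fin k → ℝ) ⬝ᵥ θ = 1 := by
    have h := EuclideanSpace.real_norm_sq_eq θ
    rw [hθ] at h
    simp only [dotProduct, ← pow_two]
    linarith
  simp [Pmat_eq, mul_sub, sub_mul, Matrix.vecMulVec_mul_vecMulVec, hdot]

lemma Pmat_mulVec_dotProduct {k : ℕ} (θ : EuclideanSpace ℝ (Fin k)) (hθ : ‖θ‖ = 1)
    (x y : Fin k → ℝ) :
    (Pmat θ).mulVec x ⬝ᵥ (Pmat θ).mulVec ((Pmat θ).mulVec y) = x ⬝ᵥ (Pmat θ).mulVec y := by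
  rw [Matrix.mulVec_mulVec, Pmat_mul_self θ hθ, Matrix.dotProduct_mulVec, Matrix.vecMul_mulVec,
    Pmat_transpose, Pmat_mul_self θ hθ, ← Matrix.dotProduct_mulVec]

/-- The quadratic form of a matrix all of whose blocks are multiples of `P`. -/
lemma dotProduct_mulVec_of_blocks {k m : ℕ} (P : Matrix (Fin k) (Fin k) ℝ)
    (g : Fin m → Fin m → ℝ) (c : Fin m → ℝ) (w : Fin m → Fin k → ℝ) :
    (fun p : Fin m × Fin k => c p.1 * w p.1 p.2) ⬝ᵥ
        (Matrix.of fun p q : Fin m × Fin k => g p.1 q.1 * P p.2 q.2).mulVec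
          (fun p => c p.1 * w p.1 p.2)
      = ∑ i, ∑ j, c i * c j * g i j * (w i ⬝ᵥ P.mulVec (w j)) := by
  simp only [dotProduct, Matrix.mulVec, Matrix.of_apply, Fintype.sum_prod_type, Finset.mul_sum]
  refine Finset.sum_congr rfl fun i _ => ?_
  rw [Finset.sum_comm]
  refine Finset.sum_congr rfl fun j _ => Finset.sum_congr rfl fun a _ =>
    Finset.sum_congr rfl fun b _ => ?_
  ring

lemma GammaPerp_eq_blocks {k m : ℕ} (θ : EuclideanSpace ℝ (Fin k)) (A B R : Fin m → ℝ) :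
    GammaPerp θ A B R = Matrix.of fun p q => ((if p.1 = q.1 then (A p.1)⁻¹ else 0)
      - (∑ l, R l * B l ^ 2 / A l)⁻¹
          * (B p.1 * B q.1 * Real.sqrt (R p.1 * R q.1) / (A p.1 * A q.1))) * Pmat θ p.2 q.2 := by
  ext p q
  simp only [GammaPerp, Matrix.of_apply, sub_mul, ite_mul, zero_mul]

/-- explicit form of the pseudo-FvML ANOVA quadratic form
`Δᵀ Γ⊥ Δ`; in particular it does not depend on the constants `κ_1, …, κ_m`. -/
theorem stmt15 {k m : ℕ} (hk : 2 ≤ k) (hm : 1 ≤ m)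
    (θ : EuclideanSpace ℝ (Fin k)) (hθ : ‖θ‖ = 1)
    (nn : Fin m → ℝ) (hnn : ∀ i, 0 < nn i)
    (n : ℝ) (hn : n = ∑ i, nn i)
    (r : Fin m → ℝ) (hr : ∀ i, r i = nn i / n)
    (κ B E : Fin m → ℝ) (hκ : ∀ i, 0 < κ i) (hB : ∀ i, 0 < B i) (hE : ∀ i, E i ≠ 0)
    (D : Fin m → ℝ) (hD : ∀ i, D i = E i / B i)
    (H : ℝ) (hH : H = ∑ i, r i * D i ^ 2 * B i)
    (A : Fin m → ℝ) (hA : ∀ i, A i = κ i ^ 2 * B i / ((k : ℝ) - 1))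
    (bb : Fin m → ℝ) (hbb : ∀ i, bb i = κ i * E i)
    (v : Fin m → (Fin k → ℝ))
    (Δ : Fin m × Fin k → ℝ)
    (hΔ : ∀ p, Δ p = κ p.1 * Real.sqrt (nn p.1) * (Pmat θ).mulVec (v p.1) p.2) :
    Δ ⬝ᵥ (GammaPerp θ A bb r).mulVec Δ
      = ((k : ℝ) - 1) *
          ((∑ i, nn i * (D i / E i) * (v i ⬝ᵥ (Pmat θ).mulVec (v i)))
            - ∑ i, ∑ j, (nn i * nn j / n) * (D i * D j / H)
                * (v i ⬝ᵥ (Pmat θ).mulVec (v j))) := by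
  have hk1 : (k : ℝ) - 1 ≠ 0 := by
    have : (2 : ℝ) ≤ k := by exact_mod_cast hk
    linarith
  generalize (k : ℝ) - 1 = K at hA hk1 ⊢
  have hn0 : 0 ≤ n := hn ▸ Finset.sum_nonneg fun i _ => (hnn i).le
  have hκ0 i : κ i ≠ 0 := (hκ i).ne'
  have hB0 i : B i ≠ 0 := (hB i).ne'
  have hH' : ∑ l, r l * bb l ^ 2 / A l = K * H := by
    rw [hH, Finset.mul_sum]
    refine Finset.sum_congr rfl fun l _ => ?_
    have := hκ0 l
    have := hB0 l
    rw [hA, hbb, hD]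
    field_simp
  have hsqrt i j : Real.sqrt (nn i) * Real.sqrt (nn j) * Real.sqrt (r i * r j)
      = nn i * nn j / n := by
    have hij : r i * r j = nn i * nn j / n ^ 2 := by rw [hr, hr]; ring
    have hpos := (mul_pos (hnn i) (hnn j)).le
    rw [hij, Real.sqrt_div hpos, Real.sqrt_sq hn0, ← Real.sqrt_mul (hnn i).le, ← mul_div_assoc,
      Real.mul_self_sqrt hpos]
  have hcoef i j : κ i * Real.sqrt (nn i) * (κ j * Real.sqrt (nn j))
        * ((K * H)⁻¹ * (bb i * bb j * Real.sqrt (r i * r j) / (A i * A j)))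
      = K * (nn i * nn j / n * (D i * D j / H)) := by
    rw [← hsqrt, hA, hA, hbb, hbb, hD, hD, mul_inv, div_eq_mul_inv _ H]
    have := hκ0 i
    have := hκ0 j
    have := hB0 i
    have := hB0 j
    generalize H⁻¹ = h
    field_simp
  have hdiag i : κ i * Real.sqrt (nn i) * (κ i * Real.sqrt (nn i)) * (A i)⁻¹
      = K * (nn i * (D i / E i)) := by
    have hs := Real.mul_self_sqrt (hnn i).le
    have := hκ0 i
    have := hB0 i
    have := hE i
    rw [hA, hD]
    field_simp
    linear_combination hs
  rw [funext hΔ, GammaPerp_eq_blocks, hH',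
    dotProduct_mulVec_of_blocks (Pmat θ)
      (fun i j => (if i = j then (A i)⁻¹ else 0)
        - (K * H)⁻¹ * (bb i * bb j * Real.sqrt (r i * r j) / (A i * A j)))
      (fun i => κ i * Real.sqrt (nn i)) (fun i => (Pmat θ).mulVec (v i))]
  simp only [Pmat_mulVec_dotProduct θ hθ, mul_sub, sub_mul, hcoef, mul_ite, mul_zero, ite_mul,
    zero_mul, Finset.sum_sub_distrib, Finset.sum_ite_eq, Finset.mem_univ, if_true, hdiag,
    Finset.mul_sum]
  simp only [mul_assoc]
end
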